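/- (Morera-type theorem, fractional case.) Assume g and h are affine: g(u) = δ₁u + δ₂, h(v) = ρ₁v + ρ₂ with δ₁, ρ₁ > 0, and let ℓ ∈ AC¹(S_{a,b,c}, ℝ_n) satisfy condition (m1); write F_I^ℓ(u + Iv) := (1/δ₁) A_I(u) + (1/ρ₁) B_I(v) for the slice functions built from ℓ. Suppose that for every I ∈ 𝕊 and every closed piecewise-C¹ curve γ : [0,1] → int(S_{a,b,c,I}) homotopic to a constant curve within int(S_{a,b,c,I}) one has ∫_0^1 γ′(t) (−I) F_I^ℓ(γ(t)) dt = 0. Then ℓ ∈ _{RL}SM^{(α,β)}_{(g,h)}(S_{a,b,c}). -/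

import Mathlib

open scoped BigOperators
open Set

noncomputable section

/-- The sphere 𝕊 of (coefficient vectors of) unit 1-vectors in ℝⁿ. -/
def USphere (n : ℕ) : Set (Fin n → ℝ) := {x | ∑ i, x i ^ 2 = 1}

/-- Points of ℝ^{n+1}, written as (x₀, (x₁, …, xₙ)). -/
abbrev Pt (n : ℕ) := ℝ × (Fin n → ℝ)

variable {n : ℕ} {Cl : Type} [NormedRing Cl] [NormedAlgebra ℝ Cl]

/-- The 1-vector of the Clifford algebra with coefficients `x` w.r.t. generators `e`. -/
def vecEmb (e : Fin n → Cl) (x : Fin n → ℝ) : Cl := ∑ i, x i • e i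

/-- The defining relations `eᵢeⱼ + eⱼeᵢ = -2δᵢⱼ` of the Clifford algebra ℝₙ. -/
def CliffordRel (e : Fin n → Cl) : Prop :=
  ∀ i j, e i * e j + e j * e i = if i = j then (-2 : Cl) else 0

/-- The slice Cauchy–Riemann operator `(∂/∂u + I ∂/∂v)` applied to the restriction of `f`
to the slice `ℂ_I`, `I = vecEmb e x`, evaluated at the point `u + I v`. -/
def sliceCR (e : Fin n → Cl) (f : Pt n → Cl) (x : Fin n → ℝ) (u v : ℝ) : Cl :=
  deriv (fun t => f (t, v • x)) u + vecEmb e x * deriv (fun t => f (u, t • x)) v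

/-- λ-slice monogenic functions on `U`. -/
def SMlam (e : Fin n → Cl) (lam : ℝ) (U : Set (Pt n)) (f : Pt n → Cl) : Prop :=
  ContDiffOn ℝ 1 f U ∧
  ∀ x ∈ USphere n, ∀ u v : ℝ, ((u, v • x) : Pt n) ∈ U →
    sliceCR e f x u v + lam • f (u, v • x) = 0

/-- The coordinates (u,v) of the slice `U_I = U ∩ ℂ_I`, `I = vecEmb e x`. -/
def SlicePre (n : ℕ) (U : Set (Pt n)) (x : Fin n → ℝ) : Set (ℝ × ℝ) :=
  {p | ((p.1, p.2 • x) : Pt n) ∈ U}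

/-- Axially symmetric slice domains in ℝ^{n+1}. -/
def AxSymSDomain (n : ℕ) (U : Set (Pt n)) : Prop :=
  IsOpen U ∧ IsConnected U ∧ (∃ u : ℝ, ((u, (0 : Fin n → ℝ)) : Pt n) ∈ U) ∧
  (∀ x ∈ USphere n, IsConnected (SlicePre n U x)) ∧
  ∀ x ∈ USphere n, ∀ y ∈ USphere n, ∀ u v : ℝ,
    ((u, v • x) : Pt n) ∈ U → ((u, v • y) : Pt n) ∈ U

/-- A holomorphic function with values in `ℂ_I`, `I = vecEmb e x`, on a
(relatively open) coordinate set `V`. -/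
def SliceHolo (e : Fin n → Cl) (x : Fin n → ℝ) (V : Set (ℝ × ℝ)) (F : ℝ × ℝ → Cl) : Prop :=
  DifferentiableOn ℝ F V ∧
  (∀ p ∈ V, ∃ a b : ℝ, F p = algebraMap ℝ Cl a + b • vecEmb e x) ∧
  ∀ p ∈ V, deriv (fun t => F (t, p.2)) p.1 + vecEmb e x * deriv (fun t => F (p.1, t)) p.2 = 0

/-- Ordered product `I_A = I_{i₁} ⋯ I_{i_k}` over a finite index set `A`. -/
def IAprod (e : Fin n → Cl) (J : Fin n → Fin n → ℝ) (A : Finset (Fin n)) : Cl :=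
  ((A.sort (· ≤ ·)).map fun i => vecEmb e (J i)).prod

/-- A closed piecewise-C¹ curve parametrized on [0,1]. -/
def PiecewiseC1 (γ : ℝ → ℝ × ℝ) : Prop :=
  ContinuousOn γ (Icc 0 1) ∧
  ∃ (k : ℕ) (t : Fin (k + 1) → ℝ), t 0 = 0 ∧ t (Fin.last k) = 1 ∧ StrictMono t ∧
    ∀ i : Fin k, ContDiffOn ℝ 1 γ (Icc (t i.castSucc) (t i.succ))

/-- `γ` is a closed curve in `V`, homotopic within `V` to a constant curve. -/
def NullHomotopicIn (γ : ℝ → ℝ × ℝ) (V : Set (ℝ × ℝ)) : Prop :=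
  γ 0 = γ 1 ∧ (∀ t ∈ Icc (0:ℝ) 1, γ t ∈ V) ∧
  ∃ (H : ℝ × ℝ → ℝ × ℝ) (p : ℝ × ℝ),
    ContinuousOn H (Icc 0 1 ×ˢ Icc 0 1) ∧
    (∀ q ∈ (Icc (0:ℝ) 1 ×ˢ Icc (0:ℝ) 1), H q ∈ V) ∧
    (∀ t ∈ Icc (0:ℝ) 1, H (0, t) = γ t) ∧
    (∀ t ∈ Icc (0:ℝ) 1, H (1, t) = p) ∧
    (∀ s ∈ Icc (0:ℝ) 1, H (s, 0) = H (s, 1))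

/-- The inverse `(a + bI)⁻¹` computed in the field `ℂ_I`, `I = vecEmb e x`. -/
def sliceInv (e : Fin n → Cl) (x : Fin n → ℝ) (a b : ℝ) : Cl :=
  (a ^ 2 + b ^ 2)⁻¹ • (algebraMap ℝ Cl a - b • vecEmb e x)

/-- The closed Euclidean ball of ℝ^{n+1}. -/
def EucClosedBall (y : Pt n) (ρ : ℝ) : Set (Pt n) :=
  {p | (p.1 - y.1) ^ 2 + ∑ i, (p.2 i - y.2 i) ^ 2 ≤ ρ ^ 2}

/-- Left fractional integral of order `σ` with respect to `g` (with derivative `g'`),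
with base point `aa`. -/
def fracInt (aa σ : ℝ) (g g' : ℝ → ℝ) (φ : ℝ → Cl) (u : ℝ) : Cl :=
  (Real.Gamma σ)⁻¹ • ∫ τ in aa..u, ((g u - g τ) ^ (σ - 1) * g' τ) • φ τ

/-- Right fractional integral of order `σ` with respect to `h` (with derivative `h'`),
with base point `cc`. -/
def fracIntR (cc σ : ℝ) (h h' : ℝ → ℝ) (φ : ℝ → Cl) (v : ℝ) : Cl :=
  (Real.Gamma σ)⁻¹ • ∫ τ in v..cc, ((h τ - h v) ^ (σ - 1) * h' τ) • φ τ

/-- Left Riemann–Liouville fractional derivative of order `al` w.r.t. `g` on `[aa, bb]`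
(one-sided derivatives at the endpoints). -/
def rlD (aa bb al : ℝ) (g g' : ℝ → ℝ) (φ : ℝ → Cl) (u : ℝ) : Cl :=
  (g' u)⁻¹ • derivWithin (fracInt aa (1 - al) g g' φ) (Icc aa bb) u

/-- The set `S_{a,b,c} ⊆ ℝ^{n+1}`. -/
def Sabc (n : ℕ) (a b c : ℝ) : Set (Pt n) :=
  {p | ∃ x ∈ USphere n, ∃ u ∈ Icc a b, ∃ v ∈ Icc 0 c, p = ((u, v • x) : Pt n)}

/-- Absolutely continuous function on `[a,b]`. -/
def AbsContOn {E : Type} [NormedAddCommGroup E] (φ : ℝ → E) (a b : ℝ) : Prop :=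
  ∀ ε > (0:ℝ), ∃ δ > (0:ℝ), ∀ (k : ℕ) (p q : Fin k → ℝ),
    (∀ i, p i ∈ Icc a b ∧ q i ∈ Icc a b ∧ p i ≤ q i) →
    (∀ i j, i ≠ j → Ioo (p i) (q i) ∩ Ioo (p j) (q j) = ∅) →
    (∑ i, (q i - p i)) < δ → (∑ i, ‖φ (q i) - φ (p i)‖) < ε

/-- The class `AC¹(S_{a,b,c}, ℝₙ)`. -/
def AC1 (a b c r s : ℝ) (f : Pt n → Cl) : Prop :=
  ContinuousOn f (Sabc n a b c) ∧
  ∀ x ∈ USphere n,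
    AbsContOn (fun u => f (u, s • x)) a b ∧ AbsContOn (fun v => f (r, v • x)) 0 c

/-- `A_I(u) = (I_{a+}^{1-α,g}[τ ↦ f(τ + Is)])(u)`, where `I = vecEmb e x`. -/
def AIfun (a al s : ℝ) (g g' : ℝ → ℝ) (f : Pt n → Cl) (x : Fin n → ℝ) : ℝ → Cl :=
  fracInt a (1 - al) g g' fun τ => f (τ, s • x)

/-- `B_I(v) = (I_{0+}^{1-β,h}[τ ↦ f(r + Iτ)])(v)`, where `I = vecEmb e x`. -/
def BIfun (be r : ℝ) (h h' : ℝ → ℝ) (f : Pt n → Cl) (x : Fin n → ℝ) : ℝ → Cl :=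
  fracInt 0 (1 - be) h h' fun τ => f (r, τ • x)

/-- `B_I^{c-}(v) = (I_{c-}^{1-β,h}[τ ↦ f(r + Iτ)])(v)`, where `I = vecEmb e x`. -/
def BIcfun (c be r : ℝ) (h h' : ℝ → ℝ) (f : Pt n → Cl) (x : Fin n → ℝ) : ℝ → Cl :=
  fracIntR c (1 - be) h h' fun τ => f (r, τ • x)

/-- Condition (m1): the maps `A_I` and `B_I` are of class C¹ for every `I ∈ 𝕊`. -/
def M1 (a b c al be r s : ℝ) (g g' h h' : ℝ → ℝ) (f : Pt n → Cl) : Prop :=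
  ∀ x ∈ USphere n,
    ContDiffOn ℝ 1 (AIfun a al s g g' f x) (Icc a b) ∧
    ContDiffOn ℝ 1 (BIfun be r h h' f x) (Icc 0 c)

/-- Riemann–Liouville fractional slice monogenic functions of order `(α,β)`
with respect to `(g,h)` on `S_{a,b,c}`. -/
def RLSM (a b c al be r s : ℝ) (g g' h h' : ℝ → ℝ) (e : Fin n → Cl) (f : Pt n → Cl) : Prop :=
  AC1 a b c r s f ∧ M1 a b c al be r s g g' h h' f ∧
  ∀ x ∈ USphere n, ∀ u ∈ Icc a b, ∀ v ∈ Icc 0 c,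
    (g' u)⁻¹ • derivWithin (AIfun a al s g g' f x) (Icc a b) u +
      vecEmb e x * ((h' v)⁻¹ • derivWithin (BIfun be r h h' f x) (Icc 0 c) v) = 0


section CircleTest

open Real Filter Topology

theorem vecEmb_mul_self {e : Fin n → Cl} (he : CliffordRel e) {x : Fin n → ℝ}
    (hx : x ∈ USphere n) : vecEmb e x * vecEmb e x = -1 := by
  have expand : vecEmb e x * vecEmb e x = ∑ i, ∑ j, (x i * x j) • (e i * e j) := by
    simp only [vecEmb, Finset.sum_mul_sum, smul_mul_smul_comm]
  have swapped : vecEmb e x * vecEmb e x = ∑ i, ∑ j, (x i * x j) • (e j * e i) := by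
    rw [expand, Finset.sum_comm]
    simp only [mul_comm (x _) (x _)]
  have double : (2 : ℝ) • (vecEmb e x * vecEmb e x) = (2 : ℝ) • (-1 : Cl) := by
    rw [two_smul]
    nth_rewrite 1 [expand]
    rw [swapped]
    simp only [← Finset.sum_add_distrib, ← smul_add, he _ _, smul_ite, smul_zero,
      Finset.sum_ite_eq, Finset.mem_univ, if_true, ← Finset.sum_smul]
    have hx' : ∑ i, x i * x i = 1 := by simpa [USphere, sq] using hx
    rw [hx', one_smul, two_smul]
    norm_num
  exact smul_right_injective Cl (two_ne_zero (α := ℝ)) double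

theorem integral_circle_affine [CompleteSpace Cl] (I w p q : Cl) (ε : ℝ) :
    ∫ θ in (0 : ℝ)..2 * π, (cos θ • (1 : Cl) + sin θ • I) *
      (w + (ε * cos θ) • p + (ε * sin θ) • q) = (ε * π) • (p + I * q) := by
  have hderiv : ∀ θ ∈ uIcc (0 : ℝ) (2 * π), HasDerivAt
      (fun θ => sin θ • w - cos θ • (I * w) + (ε * ((θ + sin θ * cos θ) / 2)) • p
        + (ε * ((θ - sin θ * cos θ) / 2)) • (I * q) + (ε * (sin θ ^ 2 / 2)) • (q + I * p))
      ((cos θ • (1 : Cl) + sin θ • I) * (w + (ε * cos θ) • p + (ε * sin θ) • q)) θ := by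
    intro θ _
    have hs := hasDerivAt_sin θ
    have hc := hasDerivAt_cos θ
    have hsc := hs.mul hc
    have hid := hasDerivAt_id θ
    convert! ((((hs.smul_const w).sub (hc.smul_const (I * w))).add
      ((((hid.add hsc).div_const 2).const_mul ε).smul_const p)).add
      ((((hid.sub hsc).div_const 2).const_mul ε).smul_const (I * q))).add
      ((((hs.pow 2).div_const 2).const_mul ε).smul_const (q + I * p)) using 1
    have h1 : (1 : ℝ) + (cos θ * cos θ + sin θ * -sin θ) = 2 * cos θ ^ 2 := by
      linear_combination -(sin_sq_add_cos_sq θ)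
    have h2 : (1 : ℝ) - (cos θ * cos θ + sin θ * -sin θ) = 2 * sin θ ^ 2 := by
      linear_combination -(sin_sq_add_cos_sq θ)
    rw [h1, h2]
    simp only [add_mul, mul_add, smul_mul_assoc, mul_smul_comm, one_mul]
    module
  rw [intervalIntegral.integral_eq_sub_of_hasDerivAt hderiv
    (Continuous.intervalIntegrable (by fun_prop) _ _)]
  simp
  module

theorem add_mul_eq_zero_of_integral_circle_eq_zero [CompleteSpace Cl]
    {p q : ℝ → Cl} {p' q' I : Cl} {u v r : ℝ} (hr : 0 < r)
    (hp : HasDerivAt p p' u) (hq : HasDerivAt q q' v)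
    (hpc : ContinuousOn p (Metric.ball u r)) (hqc : ContinuousOn q (Metric.ball v r))
    (h : ∀ ε ∈ Ioo 0 r, ∫ θ in (0 : ℝ)..2 * π, (cos θ • (1 : Cl) + sin θ • I) *
      (p (u + ε * cos θ) + q (v + ε * sin θ)) = 0) :
    p' + I * q' = 0 := by
  have key : ∀ η > 0, ‖p' + I * q'‖ ≤ η * (4 * (‖(1 : Cl)‖ + ‖I‖)) := by
    intro η hη
    have hp0 := hasDerivAt_iff_isLittleO_nhds_zero.mp hp |>.def hη
    have hq0 := hasDerivAt_iff_isLittleO_nhds_zero.mp hq |>.def hη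
    obtain ⟨d, hd, hball⟩ := Metric.eventually_nhds_iff.mp (hp0.and hq0)
    obtain ⟨ε, hε, hεd⟩ : ∃ ε, 0 < ε ∧ ε < min d r := exists_between (lt_min hd hr)
    have hεr := hεd.trans_le (min_le_right _ _)
    replace hεd := hεd.trans_le (min_le_left _ _)
    have hcle (θ : ℝ) : |ε * cos θ| ≤ ε := by
      rw [abs_mul, abs_of_pos hε]; exact mul_le_of_le_one_right hε.le (abs_cos_le_one θ)
    have hsle (θ : ℝ) : |ε * sin θ| ≤ ε := by
      rw [abs_mul, abs_of_pos hε]; exact mul_le_of_le_one_right hε.le (abs_sin_le_one θ)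
    have hpcont : Continuous fun θ => p (u + ε * cos θ) :=
      hpc.comp_continuous (by fun_prop) fun θ => by
        simpa [Real.dist_eq] using (hcle θ).trans_lt hεr
    have hqcont : Continuous fun θ => q (v + ε * sin θ) :=
      hqc.comp_continuous (by fun_prop) fun θ => by
        simpa [Real.dist_eq] using (hsle θ).trans_lt hεr
    have hdiff := intervalIntegral.integral_sub (μ := MeasureTheory.volume) (a := 0) (b := 2 * π)
      (f := fun θ => (cos θ • (1 : Cl) + sin θ • I) *
        (p (u + ε * cos θ) + q (v + ε * sin θ)))
      (g := fun θ => (cos θ • (1 : Cl) + sin θ • I) *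
        (p u + q v + (ε * cos θ) • p' + (ε * sin θ) • q'))
      (Continuous.intervalIntegrable (Continuous.mul (by fun_prop) (hpcont.add hqcont)) _ _)
      (Continuous.intervalIntegrable (by fun_prop) _ _)
    rw [h ε ⟨hε, hεr⟩, integral_circle_affine, zero_sub] at hdiff
    have hbound := intervalIntegral.norm_integral_le_of_norm_le_const (a := 0) (b := 2 * π)
      (C := (‖(1 : Cl)‖ + ‖I‖) * (η * ε + η * ε))
      (f := fun θ => (cos θ • (1 : Cl) + sin θ • I) *
          (p (u + ε * cos θ) + q (v + ε * sin θ)) -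
        (cos θ • (1 : Cl) + sin θ • I) * (p u + q v + (ε * cos θ) • p' + (ε * sin θ) • q'))
      (fun θ _ => by
        have hpθ := (hball (y := ε * cos θ)
          (by simpa [Real.dist_eq] using (hcle θ).trans_lt hεd)).1
        have hqθ := (hball (y := ε * sin θ)
          (by simpa [Real.dist_eq] using (hsle θ).trans_lt hεd)).2
        rw [← mul_sub]
        refine (norm_mul_le _ _).trans (mul_le_mul ?_ ?_ (norm_nonneg _) (by positivity))
        · refine (norm_add_le _ _).trans (add_le_add ?_ ?_) <;> rw [norm_smul]
          · exact mul_le_of_le_one_left (norm_nonneg _) (abs_cos_le_one θ)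
          · exact mul_le_of_le_one_left (norm_nonneg _) (abs_sin_le_one θ)
        · rw [show p (u + ε * cos θ) + q (v + ε * sin θ) -
              (p u + q v + (ε * cos θ) • p' + (ε * sin θ) • q') =
              (p (u + ε * cos θ) - p u - (ε * cos θ) • p') +
              (q (v + ε * sin θ) - q v - (ε * sin θ) • q') by abel]
          refine (norm_add_le _ _).trans (add_le_add (hpθ.trans ?_) (hqθ.trans ?_))
          · exact mul_le_mul_of_nonneg_left (hcle θ) hη.le
          · exact mul_le_mul_of_nonneg_left (hsle θ) hη.le)
    rw [hdiff, norm_neg, norm_smul, Real.norm_eq_abs, abs_of_pos (by positivity), sub_zero,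
      abs_of_pos (by positivity)] at hbound
    refine le_of_mul_le_mul_left (hbound.trans_eq ?_) (show 0 < ε * π by positivity)
    ring
  refine norm_le_zero_iff.mp (le_of_forall_pos_le_add fun δ hδ => ?_)
  set K := 4 * (‖(1 : Cl)‖ + ‖I‖)
  have hK : 0 ≤ K := by positivity
  refine (key (δ / (K + 1)) (by positivity)).trans ?_
  rw [zero_add, div_mul_eq_mul_div, div_le_iff₀ (by positivity)]
  nlinarith

/-- The circle of radius `ε` centred at `(u, v)`, run through once on `[0, 1]`. -/
def circleCurve (u v ε t : ℝ) : ℝ × ℝ :=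
  (u + ε * cos (2 * π * t), v + ε * sin (2 * π * t))

theorem hasDerivAt_circleCurve (u v ε t : ℝ) :
    HasDerivAt (circleCurve u v ε)
      (2 * π * ε * -sin (2 * π * t), 2 * π * ε * cos (2 * π * t)) t := by
  have hlin : HasDerivAt (fun t : ℝ => 2 * π * t) (2 * π) t := by
    simpa using (hasDerivAt_id t).const_mul (2 * π)
  refine HasDerivAt.prodMk ?_ ?_
  · convert! (hlin.cos.const_mul ε).const_add u using 1
    ring
  · convert! (hlin.sin.const_mul ε).const_add v using 1
    ring

theorem piecewiseC1_circleCurve (u v ε : ℝ) : PiecewiseC1 (circleCurve u v ε) := by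
  have hsmooth : ContDiff ℝ 1 (circleCurve u v ε) := by unfold circleCurve; fun_prop
  refine ⟨hsmooth.continuous.continuousOn, 1, ![0, 1], rfl, rfl, ?_, fun _ => hsmooth.contDiffOn⟩
  intro i j hij
  fin_cases i <;> fin_cases j <;> simp_all

theorem circleCurve_mem_Ioo_prod {a b c d u v r ε : ℝ} (hu : Metric.ball u r ⊆ Ioo a b)
    (hv : Metric.ball v r ⊆ Ioo c d) (hε : ε ∈ Ico 0 r) (t : ℝ) :
    circleCurve u v ε t ∈ Ioo a b ×ˢ Ioo c d := by
  refine ⟨hu ?_, hv ?_⟩ <;>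
    simp only [circleCurve, Metric.mem_ball, Real.dist_eq, add_sub_cancel_left, abs_mul,
      abs_of_nonneg hε.1]
  · exact (mul_le_of_le_one_right hε.1 (abs_cos_le_one _)).trans_lt hε.2
  · exact (mul_le_of_le_one_right hε.1 (abs_sin_le_one _)).trans_lt hε.2

theorem nullHomotopicIn_circleCurve {a b c d u v r ε : ℝ} (hu : Metric.ball u r ⊆ Ioo a b)
    (hv : Metric.ball v r ⊆ Ioo c d) (hε : ε ∈ Ico 0 r) :
    NullHomotopicIn (circleCurve u v ε) (Ioo a b ×ˢ Ioo c d) := by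
  refine ⟨by simp [circleCurve], fun t _ => circleCurve_mem_Ioo_prod hu hv hε t,
    fun z => circleCurve u v ((1 - z.1) * ε) z.2, (u, v), ?_, ?_, ?_, ?_, ?_⟩
  · unfold circleCurve; fun_prop
  · rintro ⟨σ, t⟩ ⟨hσ, -⟩
    refine circleCurve_mem_Ioo_prod hu hv ⟨mul_nonneg (sub_nonneg.mpr hσ.2) hε.1, ?_⟩ t
    exact (mul_le_of_le_one_left hε.1 (by linarith [hσ.1])).trans_lt hε.2
  · simp
  · simp [circleCurve]
  · simp [circleCurve]

theorem slice_derivWithin_eq_zero_of_integral_eq_zero [CompleteSpace Cl] {a b c d : ℝ}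
    (hab : a < b) (hcd : c < d) {I : Cl} (hI : I * I = -1) {p q : ℝ → Cl}
    (hp : ContDiffOn ℝ 1 p (Icc a b)) (hq : ContDiffOn ℝ 1 q (Icc c d))
    (hint : ∀ γ : ℝ → ℝ × ℝ, PiecewiseC1 γ → NullHomotopicIn γ (Ioo a b ×ˢ Ioo c d) →
      ∫ t in (0 : ℝ)..1, ((deriv γ t).1 • (1 : Cl) + (deriv γ t).2 • I) * (-I) *
        (p (γ t).1 + q (γ t).2) = 0) :
    ∀ u ∈ Icc a b, ∀ v ∈ Icc c d,
      derivWithin p (Icc a b) u + I * derivWithin q (Icc c d) v = 0 := by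
  have interior : EqOn (fun z : ℝ × ℝ => derivWithin p (Icc a b) z.1 +
      I * derivWithin q (Icc c d) z.2) (fun _ => 0) (Ioo a b ×ˢ Ioo c d) := by
    rintro ⟨u, v⟩ ⟨hu, hv⟩
    obtain ⟨r₁, hr₁, hball₁⟩ := Metric.isOpen_iff.mp isOpen_Ioo u hu
    obtain ⟨r₂, hr₂, hball₂⟩ := Metric.isOpen_iff.mp isOpen_Ioo v hv
    have hsub₁ := (Metric.ball_subset_ball (min_le_left r₁ r₂)).trans hball₁
    have hsub₂ := (Metric.ball_subset_ball (min_le_right r₁ r₂)).trans hball₂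
    refine add_mul_eq_zero_of_integral_circle_eq_zero (lt_min hr₁ hr₂)
      (((hp.differentiableOn one_ne_zero) u (Ioo_subset_Icc_self hu)).hasDerivWithinAt.hasDerivAt
        (Icc_mem_nhds hu.1 hu.2))
      (((hq.differentiableOn one_ne_zero) v (Ioo_subset_Icc_self hv)).hasDerivWithinAt.hasDerivAt
        (Icc_mem_nhds hv.1 hv.2))
      (hp.continuousOn.mono (hsub₁.trans Ioo_subset_Icc_self))
      (hq.continuousOn.mono (hsub₂.trans Ioo_subset_Icc_self)) fun ε hε => ?_
    have hzero := hint _ (piecewiseC1_circleCurve u v ε)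
      (nullHomotopicIn_circleCurve hsub₁ hsub₂ (Ioo_subset_Ico_self hε))
    obtain ⟨f, hf⟩ : ∃ f : ℝ → Cl, f = fun θ => (cos θ • (1 : Cl) + sin θ • I) *
      (p (u + ε * cos θ) + q (v + ε * sin θ)) := ⟨_, rfl⟩
    have hintegrand (t : ℝ) : ((deriv (circleCurve u v ε) t).1 • (1 : Cl) +
        (deriv (circleCurve u v ε) t).2 • I) * (-I) *
        (p (circleCurve u v ε t).1 + q (circleCurve u v ε t).2) =
        (2 * π * ε) • f (2 * π * t) := by
      rw [hf, (hasDerivAt_circleCurve u v ε t).deriv, ← smul_mul_assoc]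
      congr 1
      simp only [add_mul, smul_mul_assoc, one_mul, mul_neg, hI]
      module
    simp only [hintegrand, intervalIntegral.integral_smul] at hzero
    rw [intervalIntegral.integral_comp_mul_left _ two_pi_pos.ne'] at hzero
    rw [← hf]
    have hε0 := hε.1
    have h1 : 2 * π * ε ≠ 0 := by positivity
    have h2 : (2 * π)⁻¹ ≠ 0 := by positivity
    simpa [smul_eq_zero, h1, h2, pi_ne_zero, hε0.ne'] using hzero
  intro u hu v hv
  have hcontinuous : ContinuousOn (fun z : ℝ × ℝ => derivWithin p (Icc a b) z.1 +
      I * derivWithin q (Icc c d) z.2) (Icc a b ×ˢ Icc c d) :=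
    ((hp.continuousOn_derivWithin (uniqueDiffOn_Icc hab) le_rfl).comp continuousOn_fst
      fun _ hz => hz.1).add (continuousOn_const.mul
    ((hq.continuousOn_derivWithin (uniqueDiffOn_Icc hcd) le_rfl).comp continuousOn_snd
      fun _ hz => hz.2))
  refine interior.of_subset_closure hcontinuous continuousOn_const
    (prod_mono Ioo_subset_Icc_self Ioo_subset_Icc_self) ?_ (mk_mem_prod hu hv)
  rw [closure_prod_eq, closure_Ioo hab.ne, closure_Ioo hcd.ne]

end CircleTest

/-- Morera-type theorem, fractional case with affine `g`, `h`. -/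
theorem statement16 [CompleteSpace Cl] (e : Fin n → Cl) (he : CliffordRel e)
    (a b c r s al be δ₁ δ₂ ρ₁ ρ₂ : ℝ)
    (hab : a < b) (hc : 0 < c) (hr : r ∈ Icc a b) (hs : s ∈ Icc 0 c)
    (hal : al ∈ Ioo (0:ℝ) 1) (hbe : be ∈ Ioo (0:ℝ) 1)
    (hδ : 0 < δ₁) (hρ : 0 < ρ₁)
    (ℓ : Pt n → Cl) (hl : AC1 a b c r s ℓ)
    (hm1 : M1 a b c al be r s (fun u => δ₁ * u + δ₂) (fun _ => δ₁)
      (fun v => ρ₁ * v + ρ₂) (fun _ => ρ₁) ℓ)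
    (hint : ∀ x ∈ USphere n, ∀ γ : ℝ → ℝ × ℝ, PiecewiseC1 γ →
      NullHomotopicIn γ (Ioo a b ×ˢ Ioo 0 c) →
      ∫ t in (0:ℝ)..1,
        ((deriv γ t).1 • (1 : Cl) + (deriv γ t).2 • vecEmb e x) *
          (-(vecEmb e x)) *
          (δ₁⁻¹ • AIfun a al s (fun u => δ₁ * u + δ₂) (fun _ => δ₁) ℓ x (γ t).1
            + ρ₁⁻¹ • BIfun be r (fun v => ρ₁ * v + ρ₂) (fun _ => ρ₁) ℓ x (γ t).2) = 0) :
    RLSM a b c al be r s (fun u => δ₁ * u + δ₂) (fun _ => δ₁)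
      (fun v => ρ₁ * v + ρ₂) (fun _ => ρ₁) e ℓ := by
  refine ⟨hl, hm1, fun x hx u hu v hv => ?_⟩
  have hzero := slice_derivWithin_eq_zero_of_integral_eq_zero hab hc (vecEmb_mul_self he hx)
    ((hm1 x hx).1.const_smul δ₁⁻¹) ((hm1 x hx).2.const_smul ρ₁⁻¹) (hint x hx) u hu v hv
  rwa [derivWithin_fun_const_smul_field, derivWithin_fun_const_smul_field] at hzero
end
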